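/- Let 4/3 < α < 2 and λ = λ₁ + iλ₂ with λ₂ > 0 and λ₂ ≥ α|λ₁|/(2√(α+1)), and let u be a Schwartz-class classical solution of equation (1.1) on [0,∞). Then there exists a constant C > 0 such that for all t ≥ 1, sup_{x∈ℝ} |u(t,x)| ≤ C t^{−1/α}. -/

import Mathlib

open MeasureTheory Real Set

noncomputable section

/-- A Schwartz-class classical solution of equation (1.1),
`−i ∂_t u + c₂ ∂_x² u + i c₁ ∂_x u − c₀ u = λ |u|^α u`, on `[0,∞) × ℝ`. -/
structure SchwartzSolution (c₂ c₁ c₀ α : ℝ) (lam : ℂ) (u : ℝ → ℝ → ℂ) where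
  ut : ℝ → ℝ → ℂ
  ux : ℝ → ℝ → ℂ
  uxx : ℝ → ℝ → ℂ
  hut : ∀ x : ℝ, ∀ t ∈ Ici (0:ℝ), HasDerivWithinAt (fun s => u s x) (ut t x) (Ici 0) t
  hux : ∀ t ∈ Ici (0:ℝ), ∀ x : ℝ, HasDerivAt (fun y => u t y) (ux t x) x
  huxx : ∀ t ∈ Ici (0:ℝ), ∀ x : ℝ, HasDerivAt (fun y => ux t y) (uxx t x) x
  hu_cont : ContinuousOn (fun p : ℝ × ℝ => u p.1 p.2) (Ici 0 ×ˢ univ)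
  hut_cont : ContinuousOn (fun p : ℝ × ℝ => ut p.1 p.2) (Ici 0 ×ˢ univ)
  hux_cont : ContinuousOn (fun p : ℝ × ℝ => ux p.1 p.2) (Ici 0 ×ˢ univ)
  huxx_cont : ContinuousOn (fun p : ℝ × ℝ => uxx p.1 p.2) (Ici 0 ×ˢ univ)
  hdecay : ∀ n : ℕ, ∀ T : ℝ, 0 < T → ∃ C : ℝ, ∀ t ∈ Icc (0:ℝ) T, ∀ x : ℝ,
    (‖u t x‖ + ‖ut t x‖ + ‖ux t x‖ + ‖uxx t x‖) * (1 + |x|) ^ n ≤ C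
  heq : ∀ t : ℝ, 0 < t → ∀ x : ℝ,
    -Complex.I * ut t x + (c₂ : ℂ) * uxx t x + Complex.I * (c₁ : ℂ) * ux t x
      - (c₀ : ℂ) * u t x = lam * Complex.ofReal (‖u t x‖ ^ α) * u t x

open Filter Topology ComplexConjugate

/-- The equation satisfied by the profile `φ` of a solution after the pseudo-conformal change of
variables, together with the regularity and decay used below. -/
structure IsProfile (c₂ α : ℝ) (lam : ℂ) (φ φt φy φyy : ℝ → ℝ → ℂ) : Prop where
  hasDerivAt_t : ∀ t, 0 < t → ∀ y, HasDerivAt (fun s => φ s y) (φt t y) t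
  hasDerivAt_y : ∀ t, 0 < t → ∀ y, HasDerivAt (φ t) (φy t y) y
  hasDerivAt_yy : ∀ t, 0 < t → ∀ y, HasDerivAt (φy t) (φyy t y) y
  continuousOn_yy : ContinuousOn (fun p : ℝ × ℝ => φyy p.1 p.2) (Ioi 0 ×ˢ univ)
  decay : ∀ a b, 0 < a → ∃ C, ∀ t ∈ Icc a b, ∀ y,
    ‖φ t y‖ + ‖φt t y‖ + ‖φy t y‖ + ‖φyy t y‖ ≤ C * (1 + y ^ 2)⁻¹
  eq : ∀ t, 0 < t → ∀ y, φt t y = -Complex.I * c₂ * ((t ^ 2)⁻¹ : ℝ) * φyy t y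
    + Complex.I * lam * (t ^ (-(α / 2)) : ℝ) * (‖φ t y‖ ^ α : ℝ) * φ t y

theorem integrable_of_norm_le_inv_one_add_sq {f : ℝ → ℂ} (hf : AEStronglyMeasurable f volume)
    {C : ℝ} (h : ∀ y, ‖f y‖ ≤ C * (1 + y ^ 2)⁻¹) : Integrable f :=
  (integrable_inv_one_add_sq.const_mul C).mono' hf (Eventually.of_forall h)

theorem integrable_mul_of_norm_le_inv_one_add_sq {f g : ℝ → ℂ}
    (hf : AEStronglyMeasurable f volume) (hg : AEStronglyMeasurable g volume)
    {C D : ℝ} (hC : ∀ y, ‖f y‖ ≤ C) (hD : ∀ y, ‖g y‖ ≤ D * (1 + y ^ 2)⁻¹) :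
    Integrable fun y => f y * g y := by
  refine integrable_of_norm_le_inv_one_add_sq (C := C * D) (hf.mul hg) fun y => ?_
  rw [norm_mul, mul_assoc]
  exact mul_le_mul (hC y) (hD y) (norm_nonneg _) ((norm_nonneg _).trans (hC y))

theorem re_integral_eq {μ : Measure ℝ} {f : ℝ → ℂ} (hf : Integrable f μ) :
    (∫ y, f y ∂μ).re = ∫ y, (f y).re ∂μ :=
  (integral_re hf).symm

/-- The derivative of `|z|^α z` in the direction `w`. -/
def powDeriv (α : ℝ) (z w : ℂ) : ℂ :=
  ((α * ‖z‖ ^ (α - 2) * (z.re * w.re + z.im * w.im) : ℝ) : ℂ) * z + (‖z‖ ^ α : ℝ) * w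

theorem HasDerivAt.norm_rpow_mul_self {α : ℝ} (hα : 1 < α) {f : ℝ → ℂ} {f' : ℂ} {y : ℝ}
    (hf : HasDerivAt f f' y) :
    HasDerivAt (fun y => ((‖f y‖ ^ α : ℝ) : ℂ) * f y) (powDeriv α (f y) f') y := by
  have h := ((hasFDerivAt_norm_rpow (f y) hα).comp_hasDerivAt y hf).ofReal_comp.mul hf
  refine HasDerivAt.congr_deriv h ?_
  simp [powDeriv, Complex.inner, mul_comm]

theorem norm_powDeriv_le {α : ℝ} (hα : 0 < α) (z w : ℂ) :
    ‖powDeriv α z w‖ ≤ (α + 1) * ‖z‖ ^ α * ‖w‖ := by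
  rcases eq_or_ne z 0 with rfl | hz
  · simp [powDeriv, hα.ne']
  have hz' : 0 < ‖z‖ := norm_pos_iff.2 hz
  have hin : |z.re * w.re + z.im * w.im| ≤ ‖z‖ * ‖w‖ := by
    have := abs_real_inner_le_norm z w
    rw [Complex.inner] at this
    convert this using 2
    simp [mul_comm]
  have hk : ‖z‖ ^ α = ‖z‖ ^ (α - 2) * ‖z‖ ^ 2 := by
    rw [← rpow_natCast, ← rpow_add hz']; norm_num
  have hk0 : 0 ≤ ‖z‖ ^ (α - 2) := by positivity
  calc ‖powDeriv α z w‖ ≤ α * ‖z‖ ^ (α - 2) * |z.re * w.re + z.im * w.im| * ‖z‖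
        + ‖z‖ ^ α * ‖w‖ := by
        refine (norm_add_le _ _).trans_eq ?_
        rw [norm_mul, norm_mul, Complex.norm_real, Complex.norm_real, norm_eq_abs, norm_eq_abs,
          abs_mul, abs_of_nonneg (by positivity : 0 ≤ α * ‖z‖ ^ (α - 2)),
          abs_of_nonneg (by positivity : 0 ≤ ‖z‖ ^ α)]
    _ ≤ α * ‖z‖ ^ (α - 2) * (‖z‖ * ‖w‖) * ‖z‖ + ‖z‖ ^ α * ‖w‖ := by gcongr
    _ = _ := by rw [hk]; ring

/-- The strong dissipation condition makes the nonlinearity monotone. -/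
theorem re_mul_conj_powDeriv_nonpos {α : ℝ} (hα : 0 < α) {lam : ℂ}
    (hlam : α * |lam.re| / (2 * √(α + 1)) ≤ lam.im) (z w : ℂ) :
    (Complex.I * lam * (conj w * powDeriv α z w)).re ≤ 0 := by
  rcases eq_or_ne z 0 with rfl | hz
  · simp [powDeriv, hα.ne']
  have hz' : 0 < ‖z‖ := norm_pos_iff.2 hz
  have hk : ‖z‖ ^ α = ‖z‖ ^ (α - 2) * (z.re * z.re + z.im * z.im) := by
    rw [← Complex.normSq_apply, ← Complex.sq_norm, ← rpow_natCast, ← rpow_add hz']; norm_num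
  have hk0 : 0 ≤ ‖z‖ ^ (α - 2) := by positivity
  have hs0 : 0 < √(α + 1) := by positivity
  have hs2 : √(α + 1) ^ 2 = α + 1 := sq_sqrt (by positivity)
  rw [div_le_iff₀ (by positivity)] at hlam
  rw [powDeriv, hk]
  generalize ‖z‖ ^ (α - 2) = k at *
  generalize √(α + 1) = s at *
  set p := z.re * w.re + z.im * w.im with hp
  set q := z.re * w.im - z.im * w.re with hq
  have key : α * lam.re * p * q ≤ lam.im * ((α + 1) * p ^ 2 + q ^ 2) := by
    have hlam0 : 0 ≤ lam.im := by
      by_contra hneg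
      push Not at hneg
      have h1 : 0 ≤ α * |lam.re| := by positivity
      nlinarith [mul_pos hs0 (neg_pos.2 hneg)]
    calc α * lam.re * p * q ≤ |α * lam.re * p * q| := le_abs_self _
      _ = α * |lam.re| * (|p| * |q|) := by
        rw [abs_mul, abs_mul, abs_mul, abs_of_pos hα]; ring
      _ ≤ lam.im * (2 * s) * (|p| * |q|) := by gcongr
      _ = lam.im * (2 * (s * |p|) * |q|) := by ring
      _ ≤ lam.im * ((s * |p|) ^ 2 + |q| ^ 2) := by gcongr; exact two_mul_le_add_sq _ _
      _ = _ := by rw [mul_pow, hs2, sq_abs, sq_abs]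
  have : (Complex.I * lam * (conj w * (((α * k * p : ℝ) : ℂ) * z
      + ((k * (z.re * z.re + z.im * z.im) : ℝ) : ℂ) * w))).re
      = -(k * (lam.im * ((α + 1) * p ^ 2 + q ^ 2) - α * lam.re * p * q)) := by
    simp only [Complex.mul_re, Complex.mul_im, Complex.add_re, Complex.add_im, Complex.ofReal_re,
      Complex.ofReal_im, Complex.I_re, Complex.I_im, Complex.conj_re, Complex.conj_im]
    rw [hp, hq]
    ring
  rw [this]
  exact neg_nonpos.2 (mul_nonneg hk0 (by linarith))

/-- A function that decreases at rate `f^(3/2)` above the level `m²` is below that level after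
time `2 / (κ m)`, whatever its initial value. -/
theorem le_sq_of_hasDerivAt_le {f f' : ℝ → ℝ} {a b m κ : ℝ} (hab : a < b) (hm : 0 < m)
    (hκ : 0 < κ) (hf : ∀ t ∈ Icc a b, HasDerivAt f (f' t) t)
    (hf' : ∀ t ∈ Icc a b, m ^ 2 ≤ f t → f' t ≤ -κ * (f t * √(f t)))
    (hmκ : 2 ≤ m * (κ * (b - a))) : f b ≤ m ^ 2 := by
  by_cases hcase : ∃ s ∈ Icc a b, f s ≤ m ^ 2
  · obtain ⟨s, hs, hfs⟩ := hcase
    have hsub : ∀ t ∈ Icc s b, t ∈ Icc a b := fun t ht => ⟨hs.1.trans ht.1, ht.2⟩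
    refine image_le_of_deriv_right_lt_deriv_boundary' (f' := f') (B := fun _ => m ^ 2)
      (B' := fun _ => 0) (fun t ht => (hf t (hsub t ht)).continuousAt.continuousWithinAt)
      (fun t ht => (hf t (hsub t (Ico_subset_Icc_self ht))).hasDerivWithinAt) hfs
      continuousOn_const (fun t _ => hasDerivWithinAt_const _ _ _) (fun t ht hft => ?_)
      (right_mem_Icc.2 hs.2)
    refine (hf' t (hsub t (Ico_subset_Icc_self ht)) hft.ge).trans_lt ?_
    rw [hft]
    have : 0 < κ * (m ^ 2 * √(m ^ 2)) := by positivity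
    linarith
  · push Not at hcase
    exfalso
    have hpos : ∀ t ∈ Icc a b, 0 < f t := fun t ht => (by positivity : 0 < m ^ 2).trans (hcase t ht)
    have hd : ∀ t ∈ Icc a b, HasDerivAt (fun t => (√(f t))⁻¹)
        (-(f' t / (2 * √(f t))) / √(f t) ^ 2) t := fun t ht =>
      ((hf t ht).sqrt (hpos t ht).ne').inv (sqrt_pos.2 (hpos t ht)).ne'
    have hmono := (convex_Icc a b).mul_sub_le_image_sub_of_le_deriv (C := κ / 2)
      (f := fun t => (√(f t))⁻¹) (fun t ht => (hd t ht).continuousAt.continuousWithinAt)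
      (fun t ht => (hd t (interior_subset ht)).differentiableAt.differentiableWithinAt)
      (fun t ht => by
        have ht' := interior_subset ht
        have h0 := sqrt_pos.2 (hpos t ht')
        have h1 := hf' t ht' (hcase t ht').le
        rw [(hd t ht').deriv, sq_sqrt (hpos t ht').le, neg_div', div_div, le_div_iff₀ (by
          have := hpos t ht'; positivity)]
        linarith) a (left_mem_Icc.2 hab.le) b (right_mem_Icc.2 hab.le) hab.le
    have hfb : m < √(f b) := by
      rw [lt_sqrt hm.le]; exact hcase b (right_mem_Icc.2 hab.le)
    have hfa := sqrt_pos.2 (hpos a (left_mem_Icc.2 hab.le))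
    have h1 : κ / 2 * (b - a) < m⁻¹ := by
      have : (√(f b))⁻¹ < m⁻¹ := inv_strictAnti₀ hm hfb
      have := inv_pos.2 hfa
      linarith
    rw [← mul_lt_mul_iff_right₀ hm, mul_inv_cancel₀ hm.ne'] at h1
    linarith

namespace IsProfile

variable {c₂ α : ℝ} {lam : ℂ} {φ φt φy φyy : ℝ → ℝ → ℂ}

theorem continuous_y (h : IsProfile c₂ α lam φ φt φy φyy) {t : ℝ} (ht : 0 < t) :
    Continuous (φ t) :=
  continuous_iff_continuousAt.2 fun y => (h.hasDerivAt_y t ht y).continuousAt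

theorem continuous_yderiv (h : IsProfile c₂ α lam φ φt φy φyy) {t : ℝ} (ht : 0 < t) :
    Continuous (φy t) :=
  continuous_iff_continuousAt.2 fun y => (h.hasDerivAt_yy t ht y).continuousAt

theorem continuous_yyderiv (h : IsProfile c₂ α lam φ φt φy φyy) {t : ℝ} (ht : 0 < t) :
    Continuous (φyy t) :=
  h.continuousOn_yy.comp_continuous (f := fun y : ℝ => (t, y)) (by fun_prop)
    fun _ => ⟨ht, mem_univ _⟩

theorem continuousAt_yyderiv (h : IsProfile c₂ α lam φ φt φy φyy) {t : ℝ} (ht : 0 < t) (y : ℝ) :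
    ContinuousAt (fun s => φyy s y) t := by
  have h1 : ContinuousAt (fun p : ℝ × ℝ => φyy p.1 p.2) (t, y) :=
    h.continuousOn_yy.continuousAt (prod_mem_nhds (Ioi_mem_nhds ht) univ_mem)
  exact ContinuousAt.comp (f := fun s : ℝ => (s, y)) h1 (by fun_prop)

theorem continuous_pow (h : IsProfile c₂ α lam φ φt φy φyy) (hα : 0 < α) {t : ℝ} (ht : 0 < t) :
    Continuous fun y => ((‖φ t y‖ ^ α : ℝ) : ℂ) * φ t y := by
  have h1 : Continuous fun y => ‖φ t y‖ ^ α :=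
    (h.continuous_y ht).norm.rpow_const fun _ => Or.inr hα.le
  exact (Complex.continuous_ofReal.comp h1).mul (h.continuous_y ht)

theorem continuous_tderiv (h : IsProfile c₂ α lam φ φt φy φyy) (hα : 0 < α) {t : ℝ}
    (ht : 0 < t) : Continuous (φt t) := by
  have h1 := h.continuous_yyderiv ht
  have h2 := h.continuous_pow hα ht
  have : φt t = fun y => -Complex.I * c₂ * ((t ^ 2)⁻¹ : ℝ) * φyy t y
      + Complex.I * lam * (t ^ (-(α / 2)) : ℝ) * (((‖φ t y‖ ^ α : ℝ) : ℂ) * φ t y) := by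
    funext y; rw [h.eq t ht y]; ring
  rw [this]
  fun_prop

theorem exists_bound (h : IsProfile c₂ α lam φ φt φy φyy) {a : ℝ} (b : ℝ) (ha : 0 < a) :
    ∃ C, 0 ≤ C ∧ ∀ t ∈ Icc a b, ∀ y, ‖φ t y‖ ≤ C * (1 + y ^ 2)⁻¹ ∧
      ‖φt t y‖ ≤ C * (1 + y ^ 2)⁻¹ ∧ ‖φy t y‖ ≤ C * (1 + y ^ 2)⁻¹ ∧
      ‖φyy t y‖ ≤ C * (1 + y ^ 2)⁻¹ := by
  obtain ⟨C, hC⟩ := h.decay a b ha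
  refine ⟨max C 0, le_max_right _ _, fun t ht y => ?_⟩
  have h1 := hC t ht y
  have h2 : C * (1 + y ^ 2)⁻¹ ≤ max C 0 * (1 + y ^ 2)⁻¹ := by gcongr; exact le_max_left _ _
  have := norm_nonneg (φ t y)
  have := norm_nonneg (φt t y)
  have := norm_nonneg (φy t y)
  have := norm_nonneg (φyy t y)
  refine ⟨?_, ?_, ?_, ?_⟩ <;> linarith

theorem _root_.mul_inv_one_add_sq_le {C : ℝ} (hC : 0 ≤ C) (y : ℝ) : C * (1 + y ^ 2)⁻¹ ≤ C :=
  mul_le_of_le_one_right hC (inv_le_one_of_one_le₀ (by nlinarith [sq_nonneg y]))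

theorem integrable_sq (h : IsProfile c₂ α lam φ φt φy φyy) {t : ℝ} (ht : 0 < t) :
    Integrable fun y => ‖φy t y‖ ^ 2 := by
  obtain ⟨C, hC0, hC⟩ := h.exists_bound t ht
  have hb := fun y => (hC t (right_mem_Icc.2 le_rfl) y).2.2.1
  have hm := (h.continuous_yderiv ht).aestronglyMeasurable (μ := volume)
  refine (integrable_mul_of_norm_le_inv_one_add_sq hm hm
    (fun y => (hb y).trans (mul_inv_one_add_sq_le hC0 y)) hb).norm.congr
    (Eventually.of_forall fun y => ?_)
  simp [sq]

theorem energy_sub_energy (h : IsProfile c₂ α lam φ φt φy φyy) {s t : ℝ} (hs : 0 < s)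
    (ht : 0 < t) : (∫ y, ‖φy t y‖ ^ 2) - ∫ y, ‖φy s y‖ ^ 2 =
      -(∫ y, conj (φyy t y + φyy s y) * (φ t y - φ s y)).re := by
  obtain ⟨C, hC0, hC⟩ := h.exists_bound t ht
  obtain ⟨D, hD0, hD⟩ := h.exists_bound s hs
  replace hC := hC t (right_mem_Icc.2 le_rfl)
  replace hD := hD s (right_mem_Icc.2 le_rfl)
  have hle := fun y => mul_inv_one_add_sq_le (add_nonneg hC0 hD0) y
  have b0 : ∀ y, ‖φ t y - φ s y‖ ≤ (C + D) * (1 + y ^ 2)⁻¹ := fun y => by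
    rw [add_mul]; exact (norm_sub_le _ _).trans (add_le_add (hC y).1 (hD y).1)
  have b1 : ∀ y, ‖φy t y - φy s y‖ ≤ (C + D) * (1 + y ^ 2)⁻¹ := fun y => by
    rw [add_mul]; exact (norm_sub_le _ _).trans (add_le_add (hC y).2.2.1 (hD y).2.2.1)
  have b2 : ∀ y, ‖conj (φy t y + φy s y)‖ ≤ C + D := fun y => by
    rw [RCLike.norm_conj]
    refine le_trans ?_ (hle y)
    rw [add_mul]; exact (norm_add_le _ _).trans (add_le_add (hC y).2.2.1 (hD y).2.2.1)
  have b3 : ∀ y, ‖conj (φyy t y + φyy s y)‖ ≤ C + D := fun y => by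
    rw [RCLike.norm_conj]
    refine le_trans ?_ (hle y)
    rw [add_mul]; exact (norm_add_le _ _).trans (add_le_add (hC y).2.2.2 (hD y).2.2.2)
  have m0 : AEStronglyMeasurable (fun y => φ t y - φ s y) volume :=
    ((h.continuous_y ht).sub (h.continuous_y hs)).aestronglyMeasurable
  have m1 : AEStronglyMeasurable (fun y => φy t y - φy s y) volume :=
    ((h.continuous_yderiv ht).sub (h.continuous_yderiv hs)).aestronglyMeasurable
  have m2 : AEStronglyMeasurable (fun y => conj (φy t y + φy s y)) volume :=
    (Complex.continuous_conj.comp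
      ((h.continuous_yderiv ht).add (h.continuous_yderiv hs))).aestronglyMeasurable
  have m3 : AEStronglyMeasurable (fun y => conj (φyy t y + φyy s y)) volume :=
    (Complex.continuous_conj.comp
      ((h.continuous_yyderiv ht).add (h.continuous_yyderiv hs))).aestronglyMeasurable
  have i1 := integrable_mul_of_norm_le_inv_one_add_sq m2 m1 b2 b1
  have hparts := integral_mul_deriv_eq_deriv_mul_of_integrable
    (u := fun y => conj (φy t y + φy s y)) (u' := fun y => conj (φyy t y + φyy s y))
    (v := fun y => φ t y - φ s y) (v' := fun y => φy t y - φy s y)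
    (fun y _ => ((h.hasDerivAt_yy t ht y).add (h.hasDerivAt_yy s hs y)).star)
    (fun y _ => (h.hasDerivAt_y t ht y).sub (h.hasDerivAt_y s hs y))
    i1 (integrable_mul_of_norm_le_inv_one_add_sq m3 m0 b3 b0)
    (integrable_mul_of_norm_le_inv_one_add_sq m2 m0 b2 b0)
  rw [← Complex.neg_re, ← hparts, ← integral_sub (h.integrable_sq ht) (h.integrable_sq hs)]
  rw [re_integral_eq i1]
  refine integral_congr_ae (Eventually.of_forall fun y => ?_)
  simp only [Complex.sq_norm, Complex.normSq_apply,
    Complex.mul_re, Complex.conj_re, Complex.conj_im, Complex.add_re, Complex.add_im,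
    Complex.sub_re, Complex.sub_im]
  ring

theorem hasDerivAt_energy (h : IsProfile c₂ α lam φ φt φy φyy) {s : ℝ} (hs : 0 < s) :
    HasDerivAt (fun t => ∫ y, ‖φy t y‖ ^ 2) (-(∫ y, conj (φyy s y + φyy s y) * φt s y).re) s := by
  obtain ⟨C, hC0, hC⟩ := h.exists_bound (2 * s) (half_pos hs)
  have hsI : s ∈ Icc (s / 2) (2 * s) := ⟨by linarith, by linarith⟩
  have hnhds : Icc (s / 2) (2 * s) ∈ 𝓝 s := Icc_mem_nhds (by linarith) (by linarith)
  have hev : ∀ᶠ t in 𝓝[≠] s, t ∈ Icc (s / 2) (2 * s) := mem_nhdsWithin_of_mem_nhds hnhds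
  have hne : ∀ᶠ t in 𝓝[≠] s, t ≠ s := self_mem_nhdsWithin
  have hpos : ∀ {t}, t ∈ Icc (s / 2) (2 * s) → 0 < t := fun ht => (half_pos hs).trans_le ht.1
  have hlip : ∀ t ∈ Icc (s / 2) (2 * s), ∀ y, ‖φ t y - φ s y‖ ≤ C * (1 + y ^ 2)⁻¹ * ‖t - s‖ :=
    fun t ht y => (convex_Icc _ _).norm_image_sub_le_of_norm_hasDerivWithin_le
      (f := fun r => φ r y) (fun r hr => (h.hasDerivAt_t r (hpos hr) y).hasDerivWithinAt)
      (fun r hr => (hC r hr y).2.1) hsI ht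
  rw [hasDerivAt_iff_tendsto_slope]
  have hlim : Tendsto (fun t => ∫ y, conj (φyy t y + φyy s y) * slope (fun r => φ r y) s t)
      (𝓝[≠] s) (𝓝 (∫ y, conj (φyy s y + φyy s y) * φt s y)) := by
    refine tendsto_integral_filter_of_dominated_convergence
      (fun y => 2 * C * C * (1 + y ^ 2)⁻¹) ?_ ?_
      (integrable_inv_one_add_sq.const_mul (2 * C * C)) ?_
    · filter_upwards [hev] with t ht
      have h1 := h.continuous_yyderiv (hpos ht)
      have h2 := h.continuous_yyderiv hs
      have h3 := h.continuous_y (hpos ht)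
      have h4 := h.continuous_y hs
      refine Continuous.aestronglyMeasurable (Continuous.mul ?_ ?_)
      · exact Complex.continuous_conj.comp (h1.add h2)
      · simp only [slope_def_module]
        fun_prop
    · filter_upwards [hev, hne] with t ht hts
      refine Eventually.of_forall fun y => ?_
      have hts' : 0 < ‖t - s‖ := norm_pos_iff.2 (sub_ne_zero.2 hts)
      have h1 : ‖slope (fun r => φ r y) s t‖ ≤ C * (1 + y ^ 2)⁻¹ := by
        rw [slope_def_module, norm_smul, norm_inv, inv_mul_le_iff₀ hts', mul_comm]
        exact hlip t ht y
      have h2 : ‖conj (φyy t y + φyy s y)‖ ≤ 2 * C := by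
        rw [RCLike.norm_conj, two_mul]
        exact (norm_add_le _ _).trans (add_le_add
          ((hC t ht y).2.2.2.trans (mul_inv_one_add_sq_le hC0 y))
          ((hC s hsI y).2.2.2.trans (mul_inv_one_add_sq_le hC0 y)))
      rw [norm_mul, mul_assoc (2 * C)]
      gcongr
    · refine Eventually.of_forall fun y => Tendsto.mul ?_
        (hasDerivAt_iff_tendsto_slope.1 (h.hasDerivAt_t s hs y))
      exact (Complex.continuous_conj.tendsto _).comp
        (((h.continuousAt_yyderiv hs y).tendsto.mono_left nhdsWithin_le_nhds).add
          tendsto_const_nhds)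
  refine Tendsto.congr' ?_ ((Complex.continuous_re.tendsto _).comp hlim).neg
  filter_upwards [hev] with t ht
  rw [slope_def_module, h.energy_sub_energy hs (hpos ht), Function.comp_apply, smul_eq_mul, mul_neg,
    ← Complex.re_ofReal_mul, ← integral_const_mul]
  congr 3
  funext y
  rw [slope_def_module, Complex.real_smul]
  ring

theorem re_integral_nonneg (h : IsProfile c₂ α lam φ φt φy φyy) (hα : 1 < α)
    (hlam : α * |lam.re| / (2 * √(α + 1)) ≤ lam.im) {s : ℝ} (hs : 0 < s) :
    0 ≤ (∫ y, conj (φyy s y) * φt s y).re := by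
  have hα0 : 0 < α := by linarith
  obtain ⟨C, hC0, hC⟩ := h.exists_bound s hs
  replace hC := hC s (right_mem_Icc.2 le_rfl)
  have hle := fun y => mul_inv_one_add_sq_le hC0 y
  have c0 := h.continuous_y hs
  have c1 := h.continuous_yderiv hs
  have c2 := h.continuous_yyderiv hs
  have c3 := h.continuous_pow hα0 hs
  have m1 : AEStronglyMeasurable (fun y => conj (φy s y)) volume :=
    (Complex.continuous_conj.comp c1).aestronglyMeasurable
  have m2 : AEStronglyMeasurable (fun y => conj (φyy s y)) volume :=
    (Complex.continuous_conj.comp c2).aestronglyMeasurable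
  have b1 : ∀ y, ‖conj (φy s y)‖ ≤ C := fun y => by
    rw [RCLike.norm_conj]; exact (hC y).2.2.1.trans (hle y)
  have b2 : ∀ y, ‖conj (φyy s y)‖ ≤ C := fun y => by
    rw [RCLike.norm_conj]; exact (hC y).2.2.2.trans (hle y)
  have hpow : ∀ y, ‖φ s y‖ ^ α ≤ C ^ α := fun y =>
    rpow_le_rpow (norm_nonneg _) ((hC y).1.trans (hle y)) hα0.le
  have b3 : ∀ y, ‖((‖φ s y‖ ^ α : ℝ) : ℂ) * φ s y‖ ≤ C ^ α * C * (1 + y ^ 2)⁻¹ := fun y => by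
    rw [norm_mul, Complex.norm_of_nonneg (by positivity), mul_assoc]
    exact mul_le_mul (hpow y) (hC y).1 (norm_nonneg _) (by positivity)
  have b4 : ∀ y, ‖powDeriv α (φ s y) (φy s y)‖ ≤ (α + 1) * C ^ α * C * (1 + y ^ 2)⁻¹ := fun y => by
    refine (norm_powDeriv_le hα0 _ _).trans ?_
    rw [mul_assoc _ C]
    have := hpow y
    have := (hC y).2.2.1
    gcongr
  have m4 : AEStronglyMeasurable (fun y => powDeriv α (φ s y) (φy s y)) volume := by
    refine Measurable.aestronglyMeasurable ?_
    have := c0.measurable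
    have := c1.measurable
    unfold powDeriv
    fun_prop
  have i14 := integrable_mul_of_norm_le_inv_one_add_sq m1 m4 b1 b4
  have i23 := integrable_mul_of_norm_le_inv_one_add_sq m2 c3.aestronglyMeasurable b2 b3
  have i22 := integrable_mul_of_norm_le_inv_one_add_sq m2 c2.aestronglyMeasurable b2
    fun y => (hC y).2.2.2
  have hparts := integral_mul_deriv_eq_deriv_mul_of_integrable
    (u := fun y => conj (φy s y)) (u' := fun y => conj (φyy s y))
    (v := fun y => ((‖φ s y‖ ^ α : ℝ) : ℂ) * φ s y) (v' := fun y => powDeriv α (φ s y) (φy s y))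
    (fun y _ => (h.hasDerivAt_yy s hs y).star)
    (fun y _ => (h.hasDerivAt_y s hs y).norm_rpow_mul_self hα)
    i14 i23 (integrable_mul_of_norm_le_inv_one_add_sq m1 c3.aestronglyMeasurable b1 b3)
  have hsplit : ∫ y, conj (φyy s y) * φt s y
      = -Complex.I * c₂ * ((s ^ 2)⁻¹ : ℝ) * (∫ y, conj (φyy s y) * φyy s y)
        + Complex.I * lam * (s ^ (-(α / 2)) : ℝ) *
          ∫ y, conj (φyy s y) * (((‖φ s y‖ ^ α : ℝ) : ℂ) * φ s y) := by
    rw [← integral_const_mul, ← integral_const_mul,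
      ← integral_add (i22.const_mul _) (i23.const_mul _)]
    refine integral_congr_ae (Eventually.of_forall fun y => ?_)
    simp only [h.eq s hs y]
    ring
  have hsq : ∫ y, conj (φyy s y) * φyy s y = ((∫ y, ‖φyy s y‖ ^ 2 : ℝ) : ℂ) := by
    refine Eq.trans ?_ (integral_ofReal (𝕜 := ℂ))
    refine integral_congr_ae (Eventually.of_forall fun y => ?_)
    simp [Complex.conj_mul']
  have hnonpos : (Complex.I * lam * ∫ y, conj (φy s y) * powDeriv α (φ s y) (φy s y)).re ≤ 0 := by
    rw [← integral_const_mul]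
    rw [re_integral_eq (i14.const_mul _)]
    exact integral_nonpos fun y => re_mul_conj_powDeriv_nonpos hα0 hlam _ _
  rw [hsplit, hsq, ← neg_eq_iff_eq_neg.2 hparts, Complex.add_re]
  have e1 : (-Complex.I * c₂ * ((s ^ 2)⁻¹ : ℝ) * ((∫ y, ‖φyy s y‖ ^ 2 : ℝ) : ℂ)).re = 0 := by
    rw [mul_assoc, mul_assoc, ← Complex.ofReal_mul, ← Complex.ofReal_mul, Complex.re_mul_ofReal]
    simp
  have e2 : ∀ J : ℂ, (Complex.I * lam * (s ^ (-(α / 2)) : ℝ) * -J).re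
      = -(s ^ (-(α / 2)) * (Complex.I * lam * J).re) := fun J => by
    rw [← Complex.re_ofReal_mul, ← Complex.neg_re]; congr 1; ring
  rw [e1, e2, zero_add]
  exact neg_nonneg.2 (mul_nonpos_of_nonneg_of_nonpos (by positivity) hnonpos)

theorem energy_antitoneOn (h : IsProfile c₂ α lam φ φt φy φyy) (hα : 1 < α)
    (hlam : α * |lam.re| / (2 * √(α + 1)) ≤ lam.im) :
    AntitoneOn (fun t => ∫ y, ‖φy t y‖ ^ 2) (Ioi 0) := by
  refine antitoneOn_of_deriv_nonpos (convex_Ioi 0)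
    (fun t ht => (h.hasDerivAt_energy ht).continuousAt.continuousWithinAt)
    (fun t ht => (h.hasDerivAt_energy (interior_subset ht)).differentiableAt.differentiableWithinAt)
    fun t ht => ?_
  have ht' : 0 < t := interior_subset ht
  rw [(h.hasDerivAt_energy ht').deriv, neg_nonpos]
  have := h.re_integral_nonneg hα hlam ht'
  have e : ∀ y, conj (φyy t y + φyy t y) * φt t y = ((2 : ℝ) : ℂ) * (conj (φyy t y) * φt t y) :=
    fun y => by push_cast; rw [map_add]; ring
  simp_rw [e]
  rw [integral_const_mul, Complex.re_ofReal_mul]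
  positivity

end IsProfile

/-- The parabolic bump of integral one on the interval `[y₀ - δ, y₀ + δ]`. -/
def bump (y₀ δ y : ℝ) : ℝ := 3 / (4 * δ ^ 3) * (δ ^ 2 - (y - y₀) ^ 2)

theorem hasDerivAt_bump (y₀ δ y : ℝ) :
    HasDerivAt (bump y₀ δ) (3 / (4 * δ ^ 3) * -(2 * (y - y₀))) y := by
  have h1 := (((hasDerivAt_id y).sub_const y₀).pow 2).const_sub (δ ^ 2)
  refine (h1.const_mul (3 / (4 * δ ^ 3))).congr_deriv ?_
  simp

theorem continuous_bump (y₀ δ : ℝ) : Continuous (bump y₀ δ) := by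
  unfold bump; fun_prop

theorem bump_nonneg {y₀ δ y : ℝ} (hδ : 0 < δ) (hy : y ∈ Icc (y₀ - δ) (y₀ + δ)) :
    0 ≤ bump y₀ δ y := by
  have : 0 ≤ δ ^ 2 - (y - y₀) ^ 2 := by nlinarith [hy.1, hy.2]
  unfold bump
  positivity

theorem integral_bump (y₀ : ℝ) {δ : ℝ} (hδ : 0 < δ) :
    ∫ y in (y₀ - δ)..(y₀ + δ), bump y₀ δ y = 1 := by
  have hd : ∀ y ∈ uIcc (y₀ - δ) (y₀ + δ), HasDerivAt
      (fun y => 3 / (4 * δ ^ 3) * (δ ^ 2 * (y - y₀) - (y - y₀) ^ 3 / 3)) (bump y₀ δ y) y := by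
    intro y _
    have h0 := (hasDerivAt_id y).sub_const y₀
    refine (((h0.const_mul (δ ^ 2)).sub ((h0.pow 3).div_const 3)).const_mul
      (3 / (4 * δ ^ 3))).congr_deriv ?_
    simp [bump]
  rw [intervalIntegral.integral_eq_sub_of_hasDerivAt hd
    ((continuous_bump y₀ δ).intervalIntegrable _ _)]
  field_simp
  ring

theorem abs_deriv_bump_le {y₀ δ y : ℝ} (hδ : 0 < δ) (hy : y ∈ Icc (y₀ - δ) (y₀ + δ)) :
    |3 / (4 * δ ^ 3) * -(2 * (y - y₀))| ≤ 3 / (2 * δ ^ 2) := by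
  have : |-(2 * (y - y₀))| ≤ 2 * δ := abs_le.2 ⟨by linarith [hy.2], by linarith [hy.1]⟩
  rw [abs_mul, abs_of_nonneg (by positivity)]
  calc 3 / (4 * δ ^ 3) * |-(2 * (y - y₀))| ≤ 3 / (4 * δ ^ 3) * (2 * δ) := by gcongr
    _ = _ := by field_simp; norm_num

/-- Near a point `z`, the nonlinearity points inwards. -/
theorem re_conj_mul_pow_le {α : ℝ} (hα : 0 < α) (hα2 : α ≤ 2) {lam z w : ℂ} (hlam : 0 < lam.im)
    (h1 : ‖w - z‖ ≤ ‖z‖ / 2) (h2 : ‖lam‖ * ‖w - z‖ ≤ lam.im / 2 * ‖z‖) :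
    (conj z * (Complex.I * lam * ((‖w‖ ^ α : ℝ) * w))).re ≤
      -(lam.im / 8) * (‖z‖ ^ α * ‖z‖ ^ 2) := by
  have hlin : (conj z * (Complex.I * lam * w)).re ≤ -(lam.im / 2 * ‖z‖ ^ 2) := by
    have e : conj z * (Complex.I * lam * w)
        = Complex.I * lam * ((‖z‖ ^ 2 : ℝ) : ℂ) + conj z * (Complex.I * lam * (w - z)) := by
      rw [Complex.ofReal_pow, ← Complex.conj_mul']; ring
    have e1 : (Complex.I * lam * ((‖z‖ ^ 2 : ℝ) : ℂ)).re = -lam.im * ‖z‖ ^ 2 := by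
      rw [Complex.re_mul_ofReal]; simp
    have e2 : (conj z * (Complex.I * lam * (w - z))).re ≤ ‖z‖ * (lam.im / 2 * ‖z‖) := by
      refine (Complex.re_le_norm _).trans ?_
      rw [norm_mul, norm_mul, norm_mul, Complex.norm_I, one_mul, RCLike.norm_conj]
      gcongr
    rw [e, Complex.add_re, e1]
    nlinarith
  have hw : ‖z‖ / 2 ≤ ‖w‖ := by
    have := norm_sub_norm_le z w
    rw [norm_sub_rev] at this
    linarith
  have hpow : ‖z‖ ^ α / 4 ≤ ‖w‖ ^ α := by
    refine le_trans ?_ (rpow_le_rpow (by positivity) hw hα.le)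
    rw [div_rpow (norm_nonneg _) zero_le_two]
    have : (2 : ℝ) ^ α ≤ 4 := by
      calc (2 : ℝ) ^ α ≤ 2 ^ (2 : ℝ) := rpow_le_rpow_of_exponent_le one_le_two hα2
        _ = 4 := by norm_num
    gcongr
  have e : (conj z * (Complex.I * lam * ((‖w‖ ^ α : ℝ) * w))).re
      = ‖w‖ ^ α * (conj z * (Complex.I * lam * w)).re := by
    rw [← Complex.re_ofReal_mul]; congr 1; ring
  rw [e]
  calc ‖w‖ ^ α * (conj z * (Complex.I * lam * w)).re
      ≤ ‖w‖ ^ α * -(lam.im / 2 * ‖z‖ ^ 2) := by gcongr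
    _ ≤ ‖z‖ ^ α / 4 * -(lam.im / 2 * ‖z‖ ^ 2) :=
      mul_le_mul_of_nonpos_right hpow (neg_nonpos.2 (by positivity))
    _ = _ := by ring

/-- At times comparable to `T`, the dissipation absorbs the dispersive error. -/
theorem dissipation_dominates {c₂ α l T t r p a A : ℝ} (hc₂ : 0 < c₂) (hα : 1 ≤ α) (hl : 0 < l)
    (hT0 : 0 < T) (ht : t ∈ Icc (T / 2) T) (hr0 : 0 < r) (hp0 : 0 < p) (hp4 : T⁻¹ ≤ p ^ 4)
    (hR1 : 1 ≤ r * T ^ a) (haα : a * α = 1 - α / 2) (hA : 0 ≤ A) (hεr : p * A ≤ r)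
    (hMc : 12 * c₂ ≤ l / 8 * (r * T ^ a)) :
    2 * (-(l / 8) * t ^ (-(α / 2)) * (r ^ α * r ^ 2)
      + c₂ * (t ^ 2)⁻¹ * (3 / (2 * (p ^ 2) ^ 2) * (p * A)) * r)
      ≤ -(l / 8 * (T ^ a * T⁻¹)) * (r ^ 2 * r) := by
  have ht0 : 0 < t := by linarith [ht.1]
  have hpA : 0 ≤ p * A := by positivity
  have hpow : T⁻¹ * (r * T ^ a) ≤ t ^ (-(α / 2)) * r ^ α := by
    calc T⁻¹ * (r * T ^ a) ≤ T⁻¹ * (r * T ^ a) ^ α := by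
          gcongr
          exact self_le_rpow_of_one_le hR1 hα
      _ = T ^ (-(α / 2)) * r ^ α := by
          rw [mul_rpow hr0.le (rpow_nonneg hT0.le _), ← rpow_mul hT0.le, haα, ← rpow_neg_one,
            mul_left_comm, ← rpow_add hT0, mul_comm]
          congr 2; ring
      _ ≤ _ := by
          gcongr ?_ * _
          exact rpow_le_rpow_of_nonpos ht0 ht.2 (by linarith)
  have hdisp : (t ^ 2)⁻¹ * (3 / (2 * (p ^ 2) ^ 2)) ≤ 6 * T⁻¹ := by
    have e1 : (t ^ 2)⁻¹ ≤ 4 * (T⁻¹ * T⁻¹) := by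
      rw [show 4 * (T⁻¹ * T⁻¹) = ((T / 2) ^ 2)⁻¹ by field_simp; norm_num]
      gcongr
      exact ht.1
    have e2 : 3 / (2 * (p ^ 2) ^ 2) * T⁻¹ ≤ 3 / 2 := by
      rw [← pow_mul, div_mul_eq_mul_div, div_le_div_iff₀ (by positivity) two_pos]
      norm_num
      nlinarith
    calc (t ^ 2)⁻¹ * (3 / (2 * (p ^ 2) ^ 2)) ≤ 4 * (T⁻¹ * T⁻¹) * (3 / (2 * (p ^ 2) ^ 2)) := by gcongr
      _ = 4 * T⁻¹ * (3 / (2 * (p ^ 2) ^ 2) * T⁻¹) := by ring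
      _ ≤ 4 * T⁻¹ * (3 / 2) := by gcongr
      _ = _ := by ring
  have k1 : c₂ * (t ^ 2)⁻¹ * (3 / (2 * (p ^ 2) ^ 2) * (p * A)) * r ≤ 6 * c₂ * T⁻¹ * r ^ 2 := by
    calc _ = c₂ * ((t ^ 2)⁻¹ * (3 / (2 * (p ^ 2) ^ 2))) * (p * A) * r := by ring
      _ ≤ c₂ * (6 * T⁻¹) * r * r := by gcongr
      _ = _ := by ring
  have k2 : l / 8 * (T⁻¹ * (r * T ^ a)) * r ^ 2
      ≤ l / 8 * (t ^ (-(α / 2)) * r ^ α) * r ^ 2 := by gcongr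
  have k3 : 12 * c₂ * (T⁻¹ * r ^ 2) ≤ l / 8 * (r * T ^ a) * (T⁻¹ * r ^ 2) := by
    gcongr
  linarith

namespace IsProfile

variable {c₂ α : ℝ} {lam : ℂ} {φ φt φy φyy : ℝ → ℝ → ℂ}

theorem integral_norm_yderiv_le (h : IsProfile c₂ α lam φ φt φy φyy) {t E δ : ℝ} (ht : 0 < t)
    (hδ : 0 < δ) (hE : ∫ y, ‖φy t y‖ ^ 2 ≤ E) (y₀ : ℝ) :
    ∫ y in (y₀ - δ)..(y₀ + δ), ‖φy t y‖ ≤ √δ * (1 + E / 2) := by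
  have hc := h.continuous_yderiv ht
  have hs : 0 < √δ := sqrt_pos.2 hδ
  have hs2 : √δ * √δ = δ := mul_self_sqrt hδ.le
  have hle : y₀ - δ ≤ y₀ + δ := by linarith
  have h1 : ∫ y in (y₀ - δ)..(y₀ + δ), ‖φy t y‖ ^ 2 ≤ E := by
    rw [intervalIntegral.integral_of_le hle]
    exact (setIntegral_le_integral (h.integrable_sq ht)
      (Eventually.of_forall fun y => by positivity)).trans hE
  calc ∫ y in (y₀ - δ)..(y₀ + δ), ‖φy t y‖
      ≤ ∫ y in (y₀ - δ)..(y₀ + δ), (√δ / 2 * ‖φy t y‖ ^ 2 + (2 * √δ)⁻¹) := by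
        refine intervalIntegral.integral_mono_on hle (hc.norm.intervalIntegrable _ _)
          (Continuous.intervalIntegrable (by fun_prop) _ _) fun y _ => ?_
        have : √δ / 2 * ‖φy t y‖ ^ 2 + (2 * √δ)⁻¹ - ‖φy t y‖
            = (√δ * ‖φy t y‖ - 1) ^ 2 / (2 * √δ) := by field_simp; ring
        have : 0 ≤ (√δ * ‖φy t y‖ - 1) ^ 2 / (2 * √δ) := by positivity
        linarith
    _ = √δ / 2 * (∫ y in (y₀ - δ)..(y₀ + δ), ‖φy t y‖ ^ 2) + √δ := by
        rw [intervalIntegral.integral_add (Continuous.intervalIntegrable (by fun_prop) _ _)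
          (by simp), intervalIntegral.integral_const_mul, intervalIntegral.integral_const,
          smul_eq_mul]
        congr 1
        rw [show y₀ + δ - (y₀ - δ) = 2 * (√δ * √δ) by rw [hs2]; ring]
        field_simp
    _ ≤ √δ / 2 * E + √δ := by gcongr
    _ = _ := by ring

theorem norm_sub_le_integral (h : IsProfile c₂ α lam φ φt φy φyy) {t a b : ℝ} (ht : 0 < t)
    (hab : a ≤ b) {y y' : ℝ} (hy : y ∈ Icc a b) (hy' : y' ∈ Icc a b) :
    ‖φ t y - φ t y'‖ ≤ ∫ y in a..b, ‖φy t y‖ := by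
  have hc := h.continuous_yderiv ht
  rw [← intervalIntegral.integral_eq_sub_of_hasDerivAt (fun z _ => h.hasDerivAt_y t ht z)
    (hc.intervalIntegrable _ _), intervalIntegral.integral_of_le hab]
  refine intervalIntegral.norm_integral_le_integral_norm_uIoc.trans ?_
  refine setIntegral_mono_set (hc.norm.integrableOn_Ioc)
    (Eventually.of_forall fun y => norm_nonneg _) (LE.le.eventuallyLE ?_)
  exact Ioc_subset_Ioc (le_min hy'.1 hy.1) (max_le hy'.2 hy.2)

/-- The average of the profile against the parabolic bump. -/
def _root_.bumpAverage (φ : ℝ → ℝ → ℂ) (y₀ δ t : ℝ) : ℂ :=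
  ∫ y in (y₀ - δ)..(y₀ + δ), (bump y₀ δ y : ℂ) * φ t y

theorem norm_sub_bumpAverage_le (h : IsProfile c₂ α lam φ φt φy φyy) {t y₀ δ ε : ℝ} (ht : 0 < t)
    (hδ : 0 < δ) (hε : ∫ y in (y₀ - δ)..(y₀ + δ), ‖φy t y‖ ≤ ε) {y : ℝ}
    (hy : y ∈ Icc (y₀ - δ) (y₀ + δ)) : ‖φ t y - bumpAverage φ y₀ δ t‖ ≤ ε := by
  have hle : y₀ - δ ≤ y₀ + δ := by linarith
  have hc := h.continuous_y ht
  have hb := continuous_bump y₀ δ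
  have e : φ t y - bumpAverage φ y₀ δ t
      = ∫ z in (y₀ - δ)..(y₀ + δ), (bump y₀ δ z : ℂ) * (φ t y - φ t z) := by
    simp_rw [mul_sub]
    rw [intervalIntegral.integral_sub (Continuous.intervalIntegrable (by fun_prop) _ _)
      (Continuous.intervalIntegrable (by fun_prop) _ _), intervalIntegral.integral_mul_const,
      intervalIntegral.integral_ofReal, integral_bump y₀ hδ]
    simp [bumpAverage]
  rw [e]
  calc _ ≤ ∫ z in (y₀ - δ)..(y₀ + δ), ‖(bump y₀ δ z : ℂ) * (φ t y - φ t z)‖ :=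
        intervalIntegral.norm_integral_le_integral_norm hle
    _ ≤ ∫ z in (y₀ - δ)..(y₀ + δ), bump y₀ δ z * ε := by
        refine intervalIntegral.integral_mono_on hle
          (Continuous.intervalIntegrable (by fun_prop) _ _)
          (Continuous.intervalIntegrable (by fun_prop) _ _) fun z hz => ?_
        have h0 := bump_nonneg hδ hz
        rw [norm_mul, Complex.norm_of_nonneg h0]
        gcongr
        exact (h.norm_sub_le_integral ht hle hy hz).trans hε
    _ = ε := by rw [intervalIntegral.integral_mul_const, integral_bump y₀ hδ, one_mul]

theorem hasDerivAt_bumpAverage (h : IsProfile c₂ α lam φ φt φy φyy) (hα : 0 < α) {t : ℝ}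
    (ht : 0 < t) (y₀ δ : ℝ) :
    HasDerivAt (bumpAverage φ y₀ δ) (bumpAverage φt y₀ δ t) t := by
  obtain ⟨C, hC0, hC⟩ := h.exists_bound (2 * t) (half_pos ht)
  have hnhds : Icc (t / 2) (2 * t) ∈ 𝓝 t := Icc_mem_nhds (by linarith) (by linarith)
  have hpos : ∀ {s}, s ∈ Icc (t / 2) (2 * t) → 0 < s := fun hs => (half_pos ht).trans_le hs.1
  have hb := continuous_bump y₀ δ
  have hm : ∀ {f : ℝ → ℂ}, Continuous f → Continuous fun y => (bump y₀ δ y : ℂ) * f y :=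
    fun hf => by fun_prop
  refine (intervalIntegral.hasDerivAt_integral_of_dominated_loc_of_deriv_le
    (F := fun s y => (bump y₀ δ y : ℂ) * φ s y) (F' := fun s y => (bump y₀ δ y : ℂ) * φt s y)
    (bound := fun y => |bump y₀ δ y| * C) hnhds ?_ ((hm (h.continuous_y ht)).intervalIntegrable _ _)
    (hm (h.continuous_tderiv hα ht)).aestronglyMeasurable ?_
    (Continuous.intervalIntegrable (by fun_prop) _ _) ?_).2
  · filter_upwards [hnhds] with s hs
    exact (hm (h.continuous_y (hpos hs))).aestronglyMeasurable
  · refine Eventually.of_forall fun y _ s hs => ?_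
    rw [norm_mul, Complex.norm_real, norm_eq_abs]
    gcongr
    exact (hC s hs y).2.1.trans (mul_inv_one_add_sq_le hC0 y)
  · exact Eventually.of_forall fun y _ s hs => (h.hasDerivAt_t s (hpos hs) y).const_mul _

theorem norm_bumpAverage_yyderiv_le (h : IsProfile c₂ α lam φ φt φy φyy) {t y₀ δ ε : ℝ}
    (ht : 0 < t) (hδ : 0 < δ) (hε : ∫ y in (y₀ - δ)..(y₀ + δ), ‖φy t y‖ ≤ ε) :
    ‖bumpAverage φyy y₀ δ t‖ ≤ 3 / (2 * δ ^ 2) * ε := by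
  have hle : y₀ - δ ≤ y₀ + δ := by linarith
  have hc := h.continuous_yderiv ht
  have hcc := h.continuous_yyderiv ht
  have hparts := intervalIntegral.integral_mul_deriv_eq_deriv_mul (a := y₀ - δ) (b := y₀ + δ)
    (u := fun y => (bump y₀ δ y : ℂ)) (v := φy t)
    (u' := fun y => ((3 / (4 * δ ^ 3) * -(2 * (y - y₀)) : ℝ) : ℂ))
    (fun y _ => (hasDerivAt_bump y₀ δ y).ofReal_comp) (fun y _ => h.hasDerivAt_yy t ht y)
    (Continuous.intervalIntegrable (by fun_prop) _ _) (hcc.intervalIntegrable _ _)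
  have e1 : bump y₀ δ (y₀ + δ) = 0 := by simp [bump]
  have e2 : bump y₀ δ (y₀ - δ) = 0 := by simp [bump]
  rw [bumpAverage, hparts, e1, e2, Complex.ofReal_zero, zero_mul, zero_mul, sub_zero, zero_sub,
    norm_neg]
  calc _ ≤ ∫ y in (y₀ - δ)..(y₀ + δ), ‖((3 / (4 * δ ^ 3) * -(2 * (y - y₀)) : ℝ) : ℂ) * φy t y‖ :=
        intervalIntegral.norm_integral_le_integral_norm hle
    _ ≤ ∫ y in (y₀ - δ)..(y₀ + δ), 3 / (2 * δ ^ 2) * ‖φy t y‖ := by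
        refine intervalIntegral.integral_mono_on hle
          (Continuous.intervalIntegrable (by fun_prop) _ _)
          (Continuous.intervalIntegrable (by fun_prop) _ _) fun y hy => ?_
        rw [norm_mul, Complex.norm_real, norm_eq_abs]
        gcongr
        exact abs_deriv_bump_le hδ hy
    _ ≤ _ := by rw [intervalIntegral.integral_const_mul]; gcongr

/-- The average of the profile satisfies the dissipative ordinary differential inequality, up to
a dispersive error. -/
theorem re_conj_bumpAverage_mul_le (h : IsProfile c₂ α lam φ φt φy φyy) (hc₂ : 0 < c₂) (hα : 0 < α)
    (hα2 : α ≤ 2) (hlam : 0 < lam.im) {t y₀ δ ε : ℝ} (ht : 0 < t) (hδ : 0 < δ)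
    (hε : ∫ y in (y₀ - δ)..(y₀ + δ), ‖φy t y‖ ≤ ε)
    (h1 : ε ≤ ‖bumpAverage φ y₀ δ t‖ / 2)
    (h2 : ‖lam‖ * ε ≤ lam.im / 2 * ‖bumpAverage φ y₀ δ t‖) :
    (conj (bumpAverage φ y₀ δ t) * bumpAverage φt y₀ δ t).re ≤
      -(lam.im / 8) * t ^ (-(α / 2)) * (‖bumpAverage φ y₀ δ t‖ ^ α * ‖bumpAverage φ y₀ δ t‖ ^ 2)
        + c₂ * (t ^ 2)⁻¹ * (3 / (2 * δ ^ 2) * ε) * ‖bumpAverage φ y₀ δ t‖ := by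
  have hle : y₀ - δ ≤ y₀ + δ := by linarith
  have hosc := fun {y} => h.norm_sub_bumpAverage_le ht hδ hε (y := y)
  have hdisp := h.norm_bumpAverage_yyderiv_le ht hδ hε
  have hb := continuous_bump y₀ δ
  have hcc := h.continuous_yyderiv ht
  have hcp := h.continuous_pow hα ht
  generalize hΦ : bumpAverage φ y₀ δ t = Φ at *
  have hsplit : bumpAverage φt y₀ δ t
      = -Complex.I * c₂ * ((t ^ 2)⁻¹ : ℝ) * bumpAverage φyy y₀ δ t + (t ^ (-(α / 2)) : ℝ) *
        ∫ y in (y₀ - δ)..(y₀ + δ),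
          (bump y₀ δ y : ℂ) * (Complex.I * lam * ((‖φ t y‖ ^ α : ℝ) * φ t y)) := by
    rw [bumpAverage, bumpAverage, ← intervalIntegral.integral_const_mul,
      ← intervalIntegral.integral_const_mul,
      ← intervalIntegral.integral_add (Continuous.intervalIntegrable (by fun_prop) _ _)
        (Continuous.intervalIntegrable (by fun_prop) _ _)]
    refine intervalIntegral.integral_congr fun y _ => ?_
    simp only [h.eq t ht y]
    ring
  have hnonlin : (conj Φ * ∫ y in (y₀ - δ)..(y₀ + δ),
      (bump y₀ δ y : ℂ) * (Complex.I * lam * ((‖φ t y‖ ^ α : ℝ) * φ t y))).re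
      ≤ -(lam.im / 8) * (‖Φ‖ ^ α * ‖Φ‖ ^ 2) := by
    have hcont : Continuous fun y => conj Φ *
        ((bump y₀ δ y : ℂ) * (Complex.I * lam * ((‖φ t y‖ ^ α : ℝ) * φ t y))) := by fun_prop
    rw [← intervalIntegral.integral_const_mul, intervalIntegral.integral_of_le hle,
      re_integral_eq hcont.integrableOn_Ioc, ← intervalIntegral.integral_of_le hle]
    calc _ ≤ ∫ y in (y₀ - δ)..(y₀ + δ), bump y₀ δ y * (-(lam.im / 8) * (‖Φ‖ ^ α * ‖Φ‖ ^ 2)) := by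
          refine intervalIntegral.integral_mono_on hle
            ((Complex.continuous_re.comp hcont).intervalIntegrable _ _)
            (Continuous.intervalIntegrable (by fun_prop) _ _) fun y hy => ?_
          have e : conj Φ * ((bump y₀ δ y : ℂ) * (Complex.I * lam * ((‖φ t y‖ ^ α : ℝ) * φ t y)))
              = bump y₀ δ y * (conj Φ * (Complex.I * lam * ((‖φ t y‖ ^ α : ℝ) * φ t y))) := by ring
          rw [e, Complex.re_ofReal_mul]
          refine mul_le_mul_of_nonneg_left (re_conj_mul_pow_le hα hα2 hlam
            ((hosc hy).trans h1) (le_trans ?_ h2)) (bump_nonneg hδ hy)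
          gcongr
          exact hosc hy
      _ = _ := by rw [intervalIntegral.integral_mul_const, integral_bump y₀ hδ, one_mul]
  have hlin : (conj Φ * (-Complex.I * c₂ * ((t ^ 2)⁻¹ : ℝ) * bumpAverage φyy y₀ δ t)).re
      ≤ c₂ * (t ^ 2)⁻¹ * (3 / (2 * δ ^ 2) * ε) * ‖Φ‖ := by
    refine (Complex.re_le_norm _).trans ?_
    rw [norm_mul, norm_mul, norm_mul, norm_mul, norm_neg, Complex.norm_I, one_mul,
      RCLike.norm_conj, Complex.norm_of_nonneg hc₂.le, Complex.norm_of_nonneg (by positivity),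
      mul_comm]
    gcongr
  rw [hsplit, mul_add, Complex.add_re, mul_left_comm (conj Φ) ((t ^ (-(α / 2)) : ℝ) : ℂ),
    Complex.re_ofReal_mul]
  have := mul_le_mul_of_nonneg_left hnonlin (by positivity : 0 ≤ t ^ (-(α / 2)))
  linarith

/-- The profile decays at the rate of the dissipative ordinary differential equation. -/
theorem exists_norm_le (h : IsProfile c₂ α lam φ φt φy φyy) (hc₂ : 0 < c₂) (hα1 : 4 / 3 < α)
    (hα2 : α < 2) (hlam0 : 0 < lam.im) (hlam : α * |lam.re| / (2 * √(α + 1)) ≤ lam.im) :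
    ∃ C, 0 < C ∧ ∀ T, 1 ≤ T → ∀ y, ‖φ T y‖ ≤ C * T ^ (-(1 / α - 1 / 2)) := by
  have hα0 : 0 < α := by linarith
  set a := 1 / α - 1 / 2 with ha
  have ha0 : 0 < a := by
    rw [ha, sub_pos]; exact one_div_lt_one_div_of_lt hα0 hα2
  have ha1 : a ≤ 1 / 4 := by
    have : 1 / α ≤ 3 / 4 := by rw [div_le_div_iff₀ hα0 (by norm_num)]; linarith
    linarith
  have haα : a * α = 1 - α / 2 := by rw [ha]; field_simp
  set E := ∫ y, ‖φy (1 / 2) y‖ ^ 2 with hE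
  have hE0 : 0 ≤ E := integral_nonneg fun y => by positivity
  set A := 1 + E / 2 with hA
  have hA1 : 1 ≤ A := by linarith
  set K := 2 + 2 * ‖lam‖ / lam.im with hK
  have hK2 : 2 ≤ K := by have : 0 ≤ 2 * ‖lam‖ / lam.im := by positivity
                         linarith
  have hKl : ‖lam‖ ≤ lam.im / 2 * K := by
    rw [hK]; field_simp; nlinarith [norm_nonneg lam]
  set M := K * A + 96 * c₂ / lam.im + 32 / lam.im with hM
  have hp1 : 0 < 96 * c₂ / lam.im := by positivity
  have hp2 : 0 < 32 / lam.im := by positivity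
  have hKA : 2 ≤ K * A := by nlinarith
  have hMc : 12 * c₂ ≤ lam.im / 8 * M := by
    have : lam.im / 8 * (96 * c₂ / lam.im) = 12 * c₂ := by field_simp; norm_num
    have : 0 ≤ lam.im / 8 * (K * A + 32 / lam.im) := by positivity
    rw [hM]; linarith
  have hMl : 32 ≤ lam.im * M := by
    have : lam.im * (32 / lam.im) = 32 := by field_simp
    have : 0 ≤ lam.im * (K * A + 96 * c₂ / lam.im) := by positivity
    rw [hM]; linarith
  have hM0 : 0 < M := by linarith
  refine ⟨M + A, by linarith, fun T hT y₀ => ?_⟩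
  have hT0 : 0 < T := by linarith
  set p := T ^ (-a) with hp
  have hp0 : 0 < p := by positivity
  set P := T ^ a with hP
  have hP0 : 0 < P := by positivity
  have hPp : P * p = 1 := by rw [hP, hp, ← rpow_add hT0]; simp
  have hp4 : T⁻¹ ≤ p ^ 4 := by
    rw [hp, ← rpow_natCast, ← rpow_mul hT0.le, ← rpow_neg_one]
    exact rpow_le_rpow_of_exponent_le hT (by push_cast; linarith)
  set δ := p ^ 2 with hδdef
  have hδ : 0 < δ := by positivity
  have hsδ : √δ = p := by rw [hδdef, sqrt_sq hp0.le]
  have hIt : ∀ t ∈ Icc (T / 2) T, 0 < t := fun t ht => by linarith [ht.1]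
  have hε : ∀ t ∈ Icc (T / 2) T, ∫ y in (y₀ - δ)..(y₀ + δ), ‖φy t y‖ ≤ p * A := fun t ht => by
    rw [← hsδ]
    refine h.integral_norm_yderiv_le (hIt t ht) hδ ?_ y₀
    exact h.energy_antitoneOn (by linarith) hlam (by norm_num [mem_Ioi] : (1 / 2 : ℝ) ∈ Ioi 0)
      (hIt t ht) (by linarith [ht.1])
  set Φ := bumpAverage φ y₀ δ
  have hmain : ‖Φ T‖ ^ 2 ≤ (M * p) ^ 2 := by
    refine le_sq_of_hasDerivAt_le (f := fun t => ‖Φ t‖ ^ 2)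
      (f' := fun t => 2 * inner ℝ (Φ t) (bumpAverage φt y₀ δ t)) (a := T / 2) (b := T) (m := M * p)
      (κ := lam.im / 8 * (P * T⁻¹)) (by linarith) (by positivity) (by positivity)
      (fun t ht => (h.hasDerivAt_bumpAverage hα0 (hIt t ht) y₀ δ).norm_sq) ?_ ?_
    · intro t ht hmt
      have ht0 := hIt t ht
      have hr : M * p ≤ ‖Φ t‖ := by
        exact (pow_le_pow_iff_left₀ (by positivity) (norm_nonneg _) two_ne_zero).1 hmt
      have hKr : K * (p * A) ≤ ‖Φ t‖ := by
        refine le_trans ?_ hr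
        have : 0 ≤ (M - K * A) * p := by
          refine mul_nonneg ?_ hp0.le
          rw [hM]; linarith
        linarith
      have hpA : 0 < p * A := by positivity
      have h2pA : 2 * (p * A) ≤ K * (p * A) := by gcongr
      have hode := h.re_conj_bumpAverage_mul_le hc₂ hα0 hα2.le hlam0 ht0 hδ (hε t ht)
        (by linarith)
        (by
          calc ‖lam‖ * (p * A) ≤ lam.im / 2 * K * (p * A) := by gcongr
            _ = lam.im / 2 * (K * (p * A)) := by ring
            _ ≤ _ := by gcongr)
      simp only [sqrt_sq (norm_nonneg (Φ t))]
      rw [Complex.inner, mul_comm (bumpAverage φt y₀ δ t)]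
      generalize ‖Φ t‖ = r at *
      have hr0 : 0 < r := lt_of_lt_of_le (by positivity) (h2pA.trans hKr)
      have hR : M ≤ r * P := by
        calc M = M * p * P := by rw [mul_assoc, mul_comm p, hPp, mul_one]
          _ ≤ _ := by gcongr
      have hεr : p * A ≤ r := by linarith
      have hode' := dissipation_dominates hc₂ (by linarith) hlam0 hT0 ht hr0 hp0 hp4 (by linarith)
        haα (by linarith) hεr (hMc.trans (mul_le_mul_of_nonneg_left hR (by positivity)))
      linarith
    · have : M * p * (lam.im / 8 * (P * T⁻¹) * (T - T / 2)) = lam.im * M * (P * p) / 16 := by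
        field_simp; ring
      rw [this, hPp]
      linarith
  have hΦT : ‖Φ T‖ ≤ M * p :=
    (pow_le_pow_iff_left₀ (norm_nonneg _) (by positivity) two_ne_zero).1 hmain
  have hfin := h.norm_sub_bumpAverage_le hT0 hδ (hε T ⟨by linarith, le_rfl⟩)
    (y := y₀) ⟨by linarith, by linarith⟩
  have := norm_sub_norm_le (φ T y₀) (Φ T)
  linarith

end IsProfile

namespace SchwartzSolution

variable {c₂ c₁ c₀ α : ℝ} {lam : ℂ} {u : ℝ → ℝ → ℂ}

theorem hasDerivAt_along (sol : SchwartzSolution c₂ c₁ c₀ α lam u) {t : ℝ} (ht : 0 < t) (y : ℝ) :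
    HasDerivAt (fun s => u s (s * y - c₁ * s))
      (sol.ut t (t * y - c₁ * t) + (y - c₁) * sol.ux t (t * y - c₁ * t)) t := by
  set L : ℂ →L[ℝ] ℝ →L[ℝ] ℂ := (ContinuousLinearMap.toSpanSingletonCLE (𝕜 := ℝ) (E := ℂ) :
    ℂ →L[ℝ] ℝ →L[ℝ] ℂ) with hL
  have hnhds : Ici (0 : ℝ) ×ˢ (univ : Set ℝ) ∈ 𝓝 (t, t * y - c₁ * t) :=
    prod_mem_nhds (Ici_mem_nhds ht) univ_mem
  have hpos : ∀ᶠ v : ℝ × ℝ in 𝓝 (t, t * y - c₁ * t), 0 < v.1 :=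
    continuous_fst.continuousAt.eventually_const_lt ht
  have hF := hasStrictFDerivAt_uncurry_coprod (𝕜 := ℝ) (u := (t, t * y - c₁ * t)) (f := u)
    (f₁ := fun s x => L (sol.ut s x)) (f₂ := fun s x => L (sol.ux s x))
    (hpos.mono fun v hv =>
      ((sol.hut v.2 v.1 hv.le).hasDerivAt (Ici_mem_nhds hv)).hasFDerivAt)
    (hpos.mono fun v hv => (sol.hux v.1 hv.le v.2).hasFDerivAt)
    (L.continuous.continuousAt.comp (sol.hut_cont.continuousAt hnhds))
    (L.continuous.continuousAt.comp (sol.hux_cont.continuousAt hnhds))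
  have hcurve : HasDerivAt (fun s : ℝ => (s, s * y - c₁ * s)) (1, y - c₁) t := by
    refine (hasDerivAt_id t).prodMk ?_
    refine (((hasDerivAt_id t).mul_const y).sub ((hasDerivAt_id t).const_mul c₁)).congr_deriv ?_
    simp
  refine (hF.hasFDerivAt.comp_hasDerivAt t hcurve).congr_deriv ?_
  simp [hL, Function.HasUncurry.uncurry]

/-- The phase of the pseudo-conformal change of variables. -/
def _root_.profilePhase (c₂ c₀ t y : ℝ) : ℂ :=
  Complex.exp (Complex.I * ((t * y ^ 2 / (4 * c₂) - c₀ * t : ℝ) : ℂ))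

theorem _root_.norm_profilePhase (c₂ c₀ t y : ℝ) : ‖profilePhase c₂ c₀ t y‖ = 1 := by
  rw [profilePhase, mul_comm, Complex.norm_exp_ofReal_mul_I]

theorem _root_.hasDerivAt_profilePhase_t (c₂ c₀ t y : ℝ) :
    HasDerivAt (fun s => profilePhase c₂ c₀ s y)
      (profilePhase c₂ c₀ t y * (Complex.I * ((y ^ 2 / (4 * c₂) - c₀ : ℝ) : ℂ))) t := by
  have h1 : HasDerivAt (fun s : ℝ => s * y ^ 2 / (4 * c₂) - c₀ * s) (y ^ 2 / (4 * c₂) - c₀) t := by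
    refine ((((hasDerivAt_id t).mul_const (y ^ 2)).div_const (4 * c₂)).sub
      ((hasDerivAt_id t).const_mul c₀)).congr_deriv ?_
    simp
  exact (h1.ofReal_comp.const_mul Complex.I).cexp

theorem _root_.hasDerivAt_profilePhase_y (c₂ c₀ t y : ℝ) :
    HasDerivAt (profilePhase c₂ c₀ t)
      (profilePhase c₂ c₀ t y * (Complex.I * ((t * y / (2 * c₂) : ℝ) : ℂ))) y := by
  have h1 : HasDerivAt (fun z : ℝ => t * z ^ 2 / (4 * c₂) - c₀ * t) (t * y / (2 * c₂)) y := by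
    refine (((((hasDerivAt_id y).pow 2).const_mul t).div_const (4 * c₂)).sub_const
      (c₀ * t)).congr_deriv ?_
    simp
    ring
  exact (h1.ofReal_comp.const_mul Complex.I).cexp

theorem _root_.continuous_profilePhase (c₂ c₀ : ℝ) :
    Continuous fun p : ℝ × ℝ => profilePhase c₂ c₀ p.1 p.2 := by
  unfold profilePhase
  fun_prop

/-- The profile of a solution after the pseudo-conformal change of variables. -/
def profile (_ : SchwartzSolution c₂ c₁ c₀ α lam u) (t y : ℝ) : ℂ :=
  (√t : ℂ) * profilePhase c₂ c₀ t y * u t (t * y - c₁ * t)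

/-- The time derivative of the profile. -/
def profileT (sol : SchwartzSolution c₂ c₁ c₀ α lam u) (t y : ℝ) : ℂ :=
  (√t : ℂ) * profilePhase c₂ c₀ t y * (((2 * t)⁻¹ : ℝ) * u t (t * y - c₁ * t)
    + Complex.I * ((y ^ 2 / (4 * c₂) - c₀ : ℝ) : ℂ) * u t (t * y - c₁ * t)
    + sol.ut t (t * y - c₁ * t) + (y - c₁) * sol.ux t (t * y - c₁ * t))

/-- The first space derivative of the profile. -/
def profileY (sol : SchwartzSolution c₂ c₁ c₀ α lam u) (t y : ℝ) : ℂ :=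
  (√t : ℂ) * profilePhase c₂ c₀ t y * (Complex.I * ((t * y / (2 * c₂) : ℝ) : ℂ)
    * u t (t * y - c₁ * t) + t * sol.ux t (t * y - c₁ * t))

/-- The second space derivative of the profile. -/
def profileYY (sol : SchwartzSolution c₂ c₁ c₀ α lam u) (t y : ℝ) : ℂ :=
  (√t : ℂ) * profilePhase c₂ c₀ t y * ((Complex.I * ((t / (2 * c₂) : ℝ) : ℂ)
      - ((t * y / (2 * c₂) : ℝ) : ℂ) ^ 2) * u t (t * y - c₁ * t)
    + 2 * (Complex.I * ((t * y / (2 * c₂) : ℝ) : ℂ)) * t * sol.ux t (t * y - c₁ * t)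
    + t ^ 2 * sol.uxx t (t * y - c₁ * t))

theorem hasDerivAt_profile_t (sol : SchwartzSolution c₂ c₁ c₀ α lam u) {t : ℝ} (ht : 0 < t)
    (y : ℝ) : HasDerivAt (fun s => sol.profile s y) (sol.profileT t y) t := by
  have h1 := ((hasDerivAt_sqrt ht.ne').ofReal_comp.mul
    (hasDerivAt_profilePhase_t c₂ c₀ t y)).mul (sol.hasDerivAt_along ht y)
  refine HasDerivAt.congr_deriv h1 ?_
  have hs : (((1 / (2 * √t) : ℝ)) : ℂ) = √t * ((2 * t)⁻¹ : ℝ) := by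
    rw [← Complex.ofReal_mul]
    congr 1
    nth_rw 3 [← mul_self_sqrt ht.le]
    have := (sqrt_pos.2 ht).ne'
    field_simp
  rw [hs, profileT, Pi.mul_apply]
  ring

theorem _root_.HasDerivAt.comp_galilean {f : ℝ → ℂ} {f' : ℂ} {t c y : ℝ}
    (hf : HasDerivAt f f' (t * y - c * t)) :
    HasDerivAt (fun z => f (t * z - c * t)) (t * f') y := by
  have h1 : HasDerivAt (fun z : ℝ => t * z - c * t) t y := by
    simpa using ((hasDerivAt_id y).const_mul t).sub_const (c * t)
  refine HasDerivAt.congr_deriv (hf.scomp y h1) ?_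
  simp

theorem hasDerivAt_profile_y (sol : SchwartzSolution c₂ c₁ c₀ α lam u) {t : ℝ} (ht : 0 < t)
    (y : ℝ) : HasDerivAt (sol.profile t) (sol.profileY t y) y := by
  have h1 := ((hasDerivAt_profilePhase_y c₂ c₀ t y).const_mul (√t : ℂ)).mul
    (sol.hux t ht.le (t * y - c₁ * t)).comp_galilean
  refine HasDerivAt.congr_deriv h1 ?_
  rw [profileY]
  ring

theorem hasDerivAt_profileY (sol : SchwartzSolution c₂ c₁ c₀ α lam u) {t : ℝ} (ht : 0 < t)
    (y : ℝ) : HasDerivAt (sol.profileY t) (sol.profileYY t y) y := by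
  have h0 : HasDerivAt (fun z : ℝ => t * z / (2 * c₂)) (t / (2 * c₂)) y := by
    simpa using ((hasDerivAt_id y).const_mul t).div_const (2 * c₂)
  have h1 := ((hasDerivAt_profilePhase_y c₂ c₀ t y).const_mul (√t : ℂ)).mul
    (((h0.ofReal_comp.const_mul Complex.I).mul
      (sol.hux t ht.le (t * y - c₁ * t)).comp_galilean).add
        ((sol.huxx t ht.le (t * y - c₁ * t)).comp_galilean.const_mul (t : ℂ)))
  refine HasDerivAt.congr_deriv h1 ?_
  rw [profileYY, Pi.add_apply, Pi.mul_apply]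
  linear_combination (√t : ℂ) * profilePhase c₂ c₀ t y * ((t * y / (2 * c₂) : ℝ) : ℂ) ^ 2
    * u t (t * y - c₁ * t) * Complex.I_sq

theorem continuousOn_profileYY (sol : SchwartzSolution c₂ c₁ c₀ α lam u) :
    ContinuousOn (fun p : ℝ × ℝ => sol.profileYY p.1 p.2) (Ioi 0 ×ˢ univ) := by
  have hmap : ContinuousOn (fun p : ℝ × ℝ => (p.1, p.1 * p.2 - c₁ * p.1)) (Ioi 0 ×ˢ univ) := by
    fun_prop
  have hmem : MapsTo (fun p : ℝ × ℝ => (p.1, p.1 * p.2 - c₁ * p.1)) (Ioi 0 ×ˢ univ)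
      (Ici 0 ×ˢ univ) := fun p hp => ⟨mem_Ici.2 (mem_Ioi.1 hp.1).le, mem_univ _⟩
  have h0 := sol.hu_cont.comp hmap hmem
  have h1 := sol.hux_cont.comp hmap hmem
  have h2 := sol.huxx_cont.comp hmap hmem
  simp only [Function.comp_def] at h0 h1 h2
  have hph := (continuous_profilePhase c₂ c₀).continuousOn (s := Ioi (0 : ℝ) ×ˢ (univ : Set ℝ))
  have hsqrt : Continuous fun p : ℝ × ℝ => (√p.1 : ℂ) :=
    Complex.continuous_ofReal.comp (continuous_sqrt.comp continuous_fst)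
  have hfst : Continuous fun p : ℝ × ℝ => (p.1 : ℂ) :=
    Complex.continuous_ofReal.comp continuous_fst
  have hlin : Continuous fun p : ℝ × ℝ => ((p.1 * p.2 / (2 * c₂) : ℝ) : ℂ) :=
    Complex.continuous_ofReal.comp ((continuous_fst.mul continuous_snd).div_const _)
  have hdiv : Continuous fun p : ℝ × ℝ => ((p.1 / (2 * c₂) : ℝ) : ℂ) :=
    Complex.continuous_ofReal.comp (continuous_fst.div_const _)
  unfold profileYY
  exact (hsqrt.continuousOn.mul hph).mul
    (((((continuous_const.mul hdiv).sub (hlin.pow 2)).continuousOn.mul h0).add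
      (((continuous_const.mul (continuous_const.mul hlin)).mul hfst).continuousOn.mul h1)).add
      ((hfst.pow 2).continuousOn.mul h2))

theorem profile_eq (sol : SchwartzSolution c₂ c₁ c₀ α lam u) (hc₂ : 0 < c₂) {t : ℝ} (ht : 0 < t)
    (y : ℝ) : sol.profileT t y = -Complex.I * c₂ * ((t ^ 2)⁻¹ : ℝ) * sol.profileYY t y
      + Complex.I * lam * (t ^ (-(α / 2)) : ℝ) * (‖sol.profile t y‖ ^ α : ℝ) * sol.profile t y := by
  have hnorm : ((t ^ (-(α / 2)) : ℝ) : ℂ) * ((‖sol.profile t y‖ ^ α : ℝ) : ℂ)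
      = ((‖u t (t * y - c₁ * t)‖ ^ α : ℝ) : ℂ) := by
    rw [← Complex.ofReal_mul]
    congr 1
    rw [profile, norm_mul, norm_mul, norm_profilePhase, mul_one,
      Complex.norm_of_nonneg (sqrt_nonneg t), mul_rpow (sqrt_nonneg t) (norm_nonneg _), sqrt_eq_rpow,
      ← rpow_mul ht.le, ← mul_assoc, ← rpow_add ht]
    have : -(α / 2) + 1 / 2 * α = 0 := by ring
    rw [this, rpow_zero, one_mul]
  have heq := sol.heq t ht (t * y - c₁ * t)
  rw [mul_assoc (Complex.I * lam), hnorm]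
  rw [profileT, profileYY, profile]
  generalize sol.ut t (t * y - c₁ * t) = ut at *
  generalize sol.ux t (t * y - c₁ * t) = ux at *
  generalize sol.uxx t (t * y - c₁ * t) = uxx at *
  generalize ((‖u t (t * y - c₁ * t)‖ ^ α : ℝ) : ℂ) = N at *
  generalize u t (t * y - c₁ * t) = w at *
  have hut : ut = -Complex.I * c₂ * uxx + c₁ * ux + Complex.I * c₀ * w
      + Complex.I * lam * N * w := by
    linear_combination Complex.I * heq + (ut - c₁ * ux) * Complex.I_sq
  rw [hut]
  have ht' : (t : ℂ) ≠ 0 := by exact_mod_cast ht.ne'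
  have hc' : (c₂ : ℂ) ≠ 0 := by exact_mod_cast hc₂.ne'
  push_cast
  field_simp
  ring_nf
  simp only [Complex.I_sq]
  ring

set_option maxHeartbeats 1000000 in
theorem profile_decay (sol : SchwartzSolution c₂ c₁ c₀ α lam u) (a b : ℝ)
    (ha : 0 < a) : ∃ C, ∀ t ∈ Icc a b, ∀ y, ‖sol.profile t y‖ + ‖sol.profileT t y‖
      + ‖sol.profileY t y‖ + ‖sol.profileYY t y‖ ≤ C * (1 + y ^ 2)⁻¹ := by
  rcases lt_or_ge b a with hab | hab
  · exact ⟨0, fun t ht => absurd (ht.1.trans ht.2) (not_le.2 hab)⟩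
  have hb : 0 < b := ha.trans_le hab
  obtain ⟨C, hC⟩ := sol.hdecay 4 b hb
  have hia : 0 < a⁻¹ := inv_pos.2 ha
  have hC0 : 0 ≤ C := le_trans (by positivity) (hC a ⟨ha.le, hab⟩ 0)
  set κ := 1 + a⁻¹ + |c₁| with hκ
  have hκ0 : 0 ≤ κ := by positivity
  set d := |c₂⁻¹| with hd
  have hd0 : 0 ≤ d := abs_nonneg _
  set B := 1 + (a⁻¹ + d + |c₀| + 1 + 1 + |c₁|) + (b * d + b)
    + (b * d + (b * d) ^ 2 + 2 * (b * d) * b + b ^ 2) with hB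
  have hB0 : 0 ≤ B := by positivity
  refine ⟨√b * B * (C * κ ^ 4), fun t ht y => ?_⟩
  have ht0 : 0 < t := ha.trans_le ht.1
  have hCt := hC t ⟨ht0.le, ht.2⟩ (t * y - c₁ * t)
  have hphase : ∀ z : ℂ, ‖(√t : ℂ) * profilePhase c₂ c₀ t y * z‖ = √t * ‖z‖ := fun z => by
    rw [norm_mul, norm_mul, norm_profilePhase, mul_one, Complex.norm_of_nonneg (sqrt_nonneg t)]
  rw [profile, profileT, profileY, profileYY, hphase, hphase, hphase, hphase]
  have hg : 1 + |y| ≤ κ * (1 + |t * y - c₁ * t|) := by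
    have h1 : |y - c₁| ≤ a⁻¹ * |t * y - c₁ * t| := by
      have h2 : t * y - c₁ * t = t * (y - c₁) := by ring
      rw [h2, abs_mul, abs_of_pos ht0, ← mul_assoc]
      refine le_mul_of_one_le_left (abs_nonneg _) ?_
      rw [inv_mul_eq_div, one_le_div ha]
      exact ht.1
    have h2 : |y| ≤ |y - c₁| + |c₁| := by simpa using abs_add_le (y - c₁) c₁
    have h3 := mul_nonneg (abs_nonneg c₁) (abs_nonneg (t * y - c₁ * t))
    have h4 := abs_nonneg (t * y - c₁ * t)
    rw [hκ]
    linarith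
  generalize u t (t * y - c₁ * t) = w at *
  generalize sol.ut t (t * y - c₁ * t) = wt at *
  generalize sol.ux t (t * y - c₁ * t) = wx at *
  generalize sol.uxx t (t * y - c₁ * t) = wxx at *
  have hw := norm_nonneg w
  have hwt := norm_nonneg wt
  have hwx := norm_nonneg wx
  have hwxx := norm_nonneg wxx
  set S := ‖w‖ + ‖wt‖ + ‖wx‖ + ‖wxx‖ with hS
  set g := 1 + |y| with hgdef
  have hS0 : 0 ≤ S := by positivity
  have hy0 := abs_nonneg y
  have hg1 : 1 ≤ g := by linarith
  have hgg : g ≤ g ^ 2 := by nlinarith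
  have hg2 : 1 ≤ g ^ 2 := by linarith
  have hyg : |y| ≤ g := by linarith
  have hy2g : y ^ 2 ≤ g ^ 2 := by rw [← sq_abs]; gcongr
  have hSg : S * g ^ 4 ≤ C * κ ^ 4 := calc
    S * g ^ 4 ≤ S * (κ * (1 + |t * y - c₁ * t|)) ^ 4 := by gcongr
    _ = S * (1 + |t * y - c₁ * t|) ^ 4 * κ ^ 4 := by ring
    _ ≤ C * κ ^ 4 := by gcongr
  have hhalf : |(2 * c₂)⁻¹| ≤ d := by
    rw [hd, mul_inv, abs_mul]
    exact mul_le_of_le_one_left (abs_nonneg _) (by norm_num)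
  have hquarter : |(4 * c₂)⁻¹| ≤ d := by
    rw [hd, mul_inv, abs_mul]
    exact mul_le_of_le_one_left (abs_nonneg _) (by norm_num)
  have hty : ‖((t * y / (2 * c₂) : ℝ) : ℂ)‖ ≤ b * d * g := by
    rw [Complex.norm_real, norm_eq_abs, div_eq_mul_inv, abs_mul, abs_mul, abs_of_pos ht0,
      mul_right_comm]
    gcongr
    exact ht.2
  have htc : ‖((t / (2 * c₂) : ℝ) : ℂ)‖ ≤ b * d := by
    rw [Complex.norm_real, norm_eq_abs, div_eq_mul_inv, abs_mul, abs_of_pos ht0]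
    gcongr
    exact ht.2
  have htn : ‖(t : ℂ)‖ ≤ b := by
    rw [Complex.norm_of_nonneg ht0.le]
    exact ht.2
  have hT : ‖(((2 * t)⁻¹ : ℝ) : ℂ) * w + Complex.I * ((y ^ 2 / (4 * c₂) - c₀ : ℝ) : ℂ) * w + wt
      + (y - c₁) * wx‖ ≤ (a⁻¹ + d + |c₀| + 1 + 1 + |c₁|) * (g ^ 2 * S) := by
    have h1 : ‖(((2 * t)⁻¹ : ℝ) : ℂ)‖ ≤ a⁻¹ := by
      rw [Complex.norm_of_nonneg (by positivity)]
      exact inv_anti₀ ha (by linarith [ht.1])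
    have h2 : ‖((y ^ 2 / (4 * c₂) - c₀ : ℝ) : ℂ)‖ ≤ d * g ^ 2 + |c₀| := by
      rw [Complex.norm_real, norm_eq_abs]
      refine (abs_sub _ _).trans ?_
      rw [div_eq_mul_inv, abs_mul, abs_of_nonneg (sq_nonneg y), mul_comm]
      gcongr
    have h3 : ‖(y - c₁ : ℂ)‖ ≤ g + |c₁| := by
      rw [← Complex.ofReal_sub, Complex.norm_real, norm_eq_abs]
      exact (abs_sub _ _).trans (by gcongr)
    calc _ ≤ a⁻¹ * ‖w‖ + 1 * (d * g ^ 2 + |c₀|) * ‖w‖ + ‖wt‖ + (g + |c₁|) * ‖wx‖ := by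
          refine norm_add₄_le.trans ?_
          rw [norm_mul, norm_mul, norm_mul, norm_mul, Complex.norm_I]
          gcongr
      _ ≤ a⁻¹ * (g ^ 2 * S) + d * (g ^ 2 * S) + |c₀| * (g ^ 2 * S) + 1 * (g ^ 2 * S)
          + 1 * (g ^ 2 * S) + |c₁| * (g ^ 2 * S) := by
          have hwS : ‖w‖ ≤ S := by linarith
          have hwtS : ‖wt‖ ≤ S := by linarith
          have hwxS : ‖wx‖ ≤ S := by linarith
          have e1 : ‖w‖ ≤ g ^ 2 * S := hwS.trans (le_mul_of_one_le_left hS0 hg2)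
          have e2 : ‖wt‖ ≤ g ^ 2 * S := hwtS.trans (le_mul_of_one_le_left hS0 hg2)
          have e3 : ‖wx‖ ≤ g ^ 2 * S := hwxS.trans (le_mul_of_one_le_left hS0 hg2)
          have e4 : g * ‖wx‖ ≤ g ^ 2 * S := by gcongr
          have e5 : g ^ 2 * ‖w‖ ≤ g ^ 2 * S := by gcongr
          have f1 := mul_le_mul_of_nonneg_left e1 hia.le
          have f2 := mul_le_mul_of_nonneg_left e1 (abs_nonneg c₀)
          have f3 := mul_le_mul_of_nonneg_left e3 (abs_nonneg c₁)
          have f4 := mul_le_mul_of_nonneg_left e5 hd0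
          linarith
      _ = _ := by ring
  have hY : ‖Complex.I * ((t * y / (2 * c₂) : ℝ) : ℂ) * w + t * wx‖
      ≤ (b * d + b) * (g ^ 2 * S) := by
    calc _ ≤ 1 * (b * d * g) * ‖w‖ + b * ‖wx‖ := by
          refine (norm_add_le _ _).trans ?_
          rw [norm_mul, norm_mul, norm_mul, Complex.norm_I]
          gcongr
      _ ≤ 1 * (b * d * g ^ 2) * S + b * (g ^ 2 * S) := by
          have hwS : ‖w‖ ≤ S := by linarith
          have hwxS : ‖wx‖ ≤ g ^ 2 * S := by
            linarith [le_mul_of_one_le_left hS0 hg2]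
          gcongr
      _ = _ := by ring
  have hYY : ‖(Complex.I * ((t / (2 * c₂) : ℝ) : ℂ) - ((t * y / (2 * c₂) : ℝ) : ℂ) ^ 2) * w
      + 2 * (Complex.I * ((t * y / (2 * c₂) : ℝ) : ℂ)) * t * wx + t ^ 2 * wxx‖
      ≤ (b * d + (b * d) ^ 2 + 2 * (b * d) * b + b ^ 2) * (g ^ 2 * S) := by
    calc _ ≤ (1 * (b * d) + (b * d * g) ^ 2) * ‖w‖ + 2 * (1 * (b * d * g)) * b * ‖wx‖
          + b ^ 2 * ‖wxx‖ := by
          refine norm_add₃_le.trans ?_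
          simp only [norm_mul, norm_pow, Complex.norm_I, Complex.norm_ofNat]
          gcongr
          refine (norm_sub_le _ _).trans ?_
          rw [norm_mul, norm_pow, Complex.norm_I]
          gcongr
      _ ≤ (1 * (b * d * g ^ 2) + (b * d * g) ^ 2) * S + 2 * (1 * (b * d * g ^ 2)) * b * S
          + b ^ 2 * (g ^ 2 * S) := by
          have hwS : ‖w‖ ≤ S := by linarith
          have hwxS : ‖wx‖ ≤ S := by linarith
          have hwxxS : ‖wxx‖ ≤ g ^ 2 * S := by
            linarith [le_mul_of_one_le_left hS0 hg2]
          have hbd : b * d ≤ b * d * g ^ 2 := le_mul_of_one_le_right (by positivity) hg2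
          gcongr
      _ = _ := by ring
  have hu : ‖w‖ ≤ 1 * (g ^ 2 * S) := by linarith [le_mul_of_one_le_left hS0 hg2]
  have hone : 1 + y ^ 2 ≤ g ^ 2 := by
    rw [hgdef, add_sq, sq_abs]
    linarith
  rw [← mul_add, ← mul_add, ← mul_add, ← div_eq_mul_inv, le_div_iff₀ (by positivity)]
  calc _ ≤ √b * (B * (g ^ 2 * S)) * g ^ 2 := by
        gcongr
        · exact ht.2
        · rw [hB]
          linarith
    _ = √b * B * (S * g ^ 4) := by ring
    _ ≤ _ := by gcongr

theorem isProfile (sol : SchwartzSolution c₂ c₁ c₀ α lam u) (hc₂ : 0 < c₂) :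
    IsProfile c₂ α lam sol.profile sol.profileT sol.profileY sol.profileYY where
  hasDerivAt_t _ ht y := sol.hasDerivAt_profile_t ht y
  hasDerivAt_y _ ht y := sol.hasDerivAt_profile_y ht y
  hasDerivAt_yy _ ht y := sol.hasDerivAt_profileY ht y
  continuousOn_yy := sol.continuousOn_profileYY
  decay a b ha := sol.profile_decay a b ha
  eq _ ht y := sol.profile_eq hc₂ ht y

end SchwartzSolution

/-- For `4/3 < α < 2` and `λ₂ > 0` with `λ₂ ≥ α|λ₁|/(2√(α+1))`,
every Schwartz-class classical solution of (1.1) satisfies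
`sup_x |u(t,x)| ≤ C t^{-1/α}` for `t ≥ 1`. -/
theorem subcritical_decay_rate (c₂ c₁ c₀ α : ℝ) (hc₂ : 0 < c₂)
    (hα1 : 4 / 3 < α) (hα2 : α < 2)
    (lam : ℂ) (hlam0 : 0 < lam.im)
    (hlam : α * |lam.re| / (2 * Real.sqrt (α + 1)) ≤ lam.im)
    (u : ℝ → ℝ → ℂ) (sol : SchwartzSolution c₂ c₁ c₀ α lam u) :
    ∃ C : ℝ, 0 < C ∧ ∀ t : ℝ, 1 ≤ t → ∀ x : ℝ,
      ‖u t x‖ ≤ C * t ^ (-(1 / α)) := by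
  obtain ⟨C, hC, hbound⟩ := (sol.isProfile hc₂).exists_norm_le hc₂ hα1 hα2 hlam0 hlam
  refine ⟨C, hC, fun t ht x => ?_⟩
  have ht0 : 0 < t := by linarith
  have h1 := hbound t ht (x / t + c₁)
  have hx : t * (x / t + c₁) - c₁ * t = x := by field_simp; ring
  rw [SchwartzSolution.profile, hx, norm_mul, norm_mul, norm_profilePhase, mul_one,
    Complex.norm_of_nonneg (sqrt_nonneg t)] at h1
  have h2 : t ^ (-(1 / α - 1 / 2)) = √t * t ^ (-(1 / α)) := by
    rw [sqrt_eq_rpow, ← rpow_add ht0]; congr 1; ring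
  rw [h2, mul_left_comm] at h1
  exact le_of_mul_le_mul_left h1 (sqrt_pos.2 ht0)

end
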